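/- arXiv:1810.12978 — 2 statements merged into one kernel-verified Lean document; each statement's English description precedes it below -/
import Mathlib

section
/- For a prime p, α > 0, integer r, and t > 0, the heat kernel Z_r(x,t) = ∫ χ(-xξ) e^{-t(max(|ξ|_p,p^r)^α - p^{rα})} dξ is nonnegative: Z_r(x,t) ≥ 0 for all x ∈ ℚ_p. -/
open MeasureTheory Filter Topology

noncomputable section

variable (p : ℕ) [Fact p.Prime]

instance : MeasurableSpace ℚ_[p] := borel _
instance : BorelSpace ℚ_[p] := ⟨rfl⟩

/-- The closed unit ball of `ℚ_[p]` (i.e. `ℤ_p`) as a positive compact set. -/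
def padicUnitBall : TopologicalSpace.PositiveCompacts ℚ_[p] where
  carrier := Metric.closedBall 0 1
  isCompact' := isCompact_closedBall 0 1
  interior_nonempty' := ⟨0, mem_interior_iff_mem_nhds.2 (Metric.closedBall_mem_nhds 0 one_pos)⟩

/-- Haar measure on `ℚ_[p]` normalized so that `ℤ_p` has measure 1. -/
def μp : Measure ℚ_[p] := Measure.addHaarMeasure (padicUnitBall p)

/-- The heat kernel `Z_r(x,t) = ∫ χ(-xξ) e^{-t(⟨ξ⟩^α - p^{rα})} dξ`, where
`⟨ξ⟩ = max(|ξ|_p, p^r)`. -/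
def heatKernel (χ : AddChar ℚ_[p] ℂ) (r : ℤ) (α t : ℝ) (x : ℚ_[p]) : ℂ :=
  ∫ ξ, χ (-(x*ξ)) *
    Complex.exp (-((t * ((max ‖ξ‖ ((p:ℝ)^r)) ^ α - (p:ℝ) ^ ((r:ℝ)*α)) : ℝ) : ℂ)) ∂(μp p)

/-- The kernel `K_α(y)`, supported on the ball `|y|_p ≤ p^{-r}`. -/
def Kfun (r : ℤ) (α : ℝ) (y : ℚ_[p]) : ℝ :=
  if ‖y‖ ≤ (p:ℝ)^(-r) then
    (1 - (p:ℝ)^α)/(1 - (p:ℝ)^(-α-1)) * ‖y‖ ^ (-α-1)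
      + (p:ℝ)^((r:ℝ)*(α+1)) * (1 - (p:ℝ)^α)/(1 - (p:ℝ)^(α+1))
  else 0

/-- `u(x,t) = ∫_{|ξ|_p ≤ 1} χ(-xξ) e^{-t(⟨ξ⟩^α - p^{rα})} dξ`, the solution with initial
datum the indicator of the unit ball. -/
def uball (χ : AddChar ℚ_[p] ℂ) (r : ℤ) (α t : ℝ) (x : ℚ_[p]) : ℂ :=
  ∫ ξ in {ξ : ℚ_[p] | ‖ξ‖ ≤ 1}, χ (-(x*ξ)) *
    Complex.exp (-((t * ((max ‖ξ‖ ((p:ℝ)^r)) ^ α - (p:ℝ) ^ ((r:ℝ)*α)) : ℝ) : ℂ)) ∂(μp p)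

/-- The survival probability `S(t) = ∫_{|x|_p ≤ 1} u(x,t) dx`. -/
def Sfun (χ : AddChar ℚ_[p] ℂ) (r : ℤ) (α t : ℝ) : ℂ :=
  ∫ x in {x : ℚ_[p] | ‖x‖ ≤ 1}, uball p χ r α t x ∂(μp p)

/-- The solution `u(x,t) = (Z_r(·,t) ∗ φ)(x)` of the Cauchy problem, with `u(x,0) = φ(x)`. -/
def sol (χ : AddChar ℚ_[p] ℂ) (r : ℤ) (α : ℝ) (φ : ℚ_[p] → ℂ) (t : ℝ) (x : ℚ_[p]) : ℂ :=
  if t = 0 then φ x else ∫ y, heatKernel p χ r α t (x-y) * φ y ∂(μp p)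

/-- The pseudodifferential operator `H^α` with symbol `⟨ξ⟩^α - p^{rα}`:
`H^α g = 𝓕⁻¹[(⟨ξ⟩^α - p^{rα}) 𝓕g]`. -/
def Hop (χ : AddChar ℚ_[p] ℂ) (r : ℤ) (α : ℝ) (g : ℚ_[p] → ℂ) (x : ℚ_[p]) : ℂ :=
  ∫ ξ, χ (-(x*ξ)) * (((max ‖ξ‖ ((p:ℝ)^r)) ^ α - (p:ℝ)^((r:ℝ)*α) : ℝ) : ℂ) *
    (∫ y, χ (ξ*y) * g y ∂(μp p)) ∂(μp p)

/-- The Laplace transform `G_r(s)` of the density `g(t)`. -/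
def Gr (χ : AddChar ℚ_[p] ℂ) (r : ℤ) (α : ℝ) (s : ℝ) : ℂ :=
  ∫ y in {y : ℚ_[p] | 1 < ‖y‖ ∧ ‖y‖ ≤ (p:ℝ)^(-r)}, (Kfun p r α y : ℂ) *
    ∫ ξ in {ξ : ℚ_[p] | ‖ξ‖ ≤ 1},
      χ (-(ξ*y)) / ((s:ℂ) + (((max ‖ξ‖ ((p:ℝ)^r)) ^ α - (p:ℝ)^((r:ℝ)*α) : ℝ) : ℂ)) ∂(μp p) ∂(μp p)

/-- The integral of an additive character over a set stable under translation by its own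
elements is a nonnegative real number. -/
lemma exists_nonneg_integral_addChar_indicator {G : Type*} [AddCommGroup G] [MeasurableSpace G]
    [MeasurableAdd G] (μ : Measure G) [μ.IsAddLeftInvariant] (c : AddChar G ℂ) (H : AddSubgroup G)
    (hH : MeasurableSet (H : Set G)) :
    ∃ v : ℝ, 0 ≤ v ∧ ∫ g, (H : Set G).indicator c g ∂μ = v := by
  by_cases h : ∀ g ∈ H, c g = 1
  · refine ⟨μ.real H, measureReal_nonneg, ?_⟩
    rw [integral_indicator hH, setIntegral_congr_fun hH (g := fun _ => (1 : ℂ)) h]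
    simp
  · push Not at h
    obtain ⟨a, ha, hca⟩ := h
    refine ⟨0, le_rfl, ?_⟩
    have key : ∫ g, (H : Set G).indicator c g ∂μ
        = c a * ∫ g, (H : Set G).indicator c g ∂μ := by
      rw [← integral_const_mul, ← integral_add_left_eq_self _ a]
      congr 1 with g
      by_cases hg : g ∈ H
      · rw [Set.indicator_of_mem (H.add_mem ha hg), Set.indicator_of_mem hg,
          AddChar.map_add_eq_mul]
      · rw [Set.indicator_of_notMem (by simpa [H.add_mem_cancel_left ha] using hg),
          Set.indicator_of_notMem (by simpa using hg), mul_zero]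
    have : (c a - 1) * ∫ g, (H : Set G).indicator c g ∂μ = 0 := by
      rw [sub_mul, ← key, one_mul, sub_self]
    simpa [sub_ne_zero.2 hca] using this

/-- If all superlevel sets of a nonnegative function `φ` are subgroups (or empty), then the
integral of `φ` against a unitary character is a nonnegative real number. -/
lemma exists_nonneg_integral_addChar_mul {G : Type*} [AddCommGroup G] [MeasurableSpace G]
    [MeasurableAdd G] (μ : Measure G) [SFinite μ] [μ.IsAddLeftInvariant] (c : AddChar G ℂ)
    (hcm : Measurable c) (hc : ∀ g, ‖c g‖ = 1) (φ : G → ℝ) (hφm : Measurable φ)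
    (hφ : ∀ g, 0 ≤ φ g) (hneg : ∀ g, φ (-g) = φ g) (hzero : ∀ g, φ g ≤ φ 0)
    (hadd : ∀ g h, min (φ g) (φ h) ≤ φ (g + h)) :
    ∃ v : ℝ, 0 ≤ v ∧ ∫ g, c g * (φ g : ℂ) ∂μ = v := by
  by_cases hint : Integrable (fun g => c g * (φ g : ℂ)) μ
  swap
  · exact ⟨0, le_rfl, by rw [integral_undef hint, Complex.ofReal_zero]⟩
  let F : G → ℝ → ℂ := fun g s => if s < φ g then c g else 0
  have hF (g : G) : F g = (Set.Iio (φ g)).indicator fun _ => c g := by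
    ext s; simp [F, Set.indicator_apply]
  have hinter (g : G) : Set.Iio (φ g) ∩ Set.Ioi 0 = Set.Ioo 0 (φ g) := by
    ext; simp [and_comm]
  have hF_int (g : G) : ∫ s in Set.Ioi 0, F g s = c g * (φ g : ℂ) := by
    rw [hF, integral_indicator measurableSet_Iio, Measure.restrict_restrict measurableSet_Iio,
      hinter]
    simp [hφ g, mul_comm]
  have hF_norm (g : G) : ∫ s in Set.Ioi 0, ‖F g s‖ = φ g := by
    simp_rw [hF, norm_indicator_eq_indicator_norm]
    rw [integral_indicator measurableSet_Iio, Measure.restrict_restrict measurableSet_Iio, hinter]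
    simp [hφ g, hc]
  have hFm : Measurable (Function.uncurry F) :=
    Measurable.ite (measurableSet_lt measurable_snd (hφm.comp measurable_fst))
      (hcm.comp measurable_fst) measurable_const
  have hprod : Integrable (Function.uncurry F) (μ.prod (volume.restrict (Set.Ioi 0))) := by
    rw [integrable_prod_iff hFm.aestronglyMeasurable]
    refine ⟨.of_forall fun g => ?_, ?_⟩
    · change Integrable (F g) _
      rw [hF, integrable_indicator_iff measurableSet_Iio, IntegrableOn,
        Measure.restrict_restrict measurableSet_Iio, hinter]
      exact integrableOn_const (by simp)
    · simp only [Function.uncurry_apply_pair, hF_norm]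
      refine hint.norm.congr (.of_forall fun g => ?_)
      simp [hc, abs_of_nonneg (hφ g)]
  have hlevel (s : ℝ) : ∃ v : ℝ, 0 ≤ v ∧ ∫ g, F g s ∂μ = v := by
    by_cases hs : s < φ 0
    · let H : AddSubgroup G :=
        { carrier := {g | s < φ g}
          zero_mem' := hs
          add_mem' := fun {g h} hg hh => (lt_min hg hh).trans_le (hadd g h)
          neg_mem' := fun {g} hg => by simpa [hneg] using hg }
      obtain ⟨v, hv, h⟩ := exists_nonneg_integral_addChar_indicator μ c H
        (measurableSet_lt measurable_const hφm)
      refine ⟨v, hv, h ▸ ?_⟩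
      congr 1
    · refine ⟨0, le_rfl, ?_⟩
      have (g : G) : F g s = 0 := if_neg fun h => hs (h.trans_le (hzero g))
      simp [this]
  choose v hv hFv using hlevel
  refine ⟨∫ s in Set.Ioi 0, v s, integral_nonneg hv, ?_⟩
  simp_rw [← hF_int]
  rw [integral_integral_swap hprod]
  simp_rw [hFv]
  exact integral_ofReal

variable {p} in
/-- A character of `ℚ_[p]` trivial on the unit ball is unitary. -/
lemma norm_addChar_eq_one {χ : AddChar ℚ_[p] ℂ} (hχ : ∀ y : ℚ_[p], ‖y‖ ≤ 1 → χ y = 1)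
    (y : ℚ_[p]) : ‖χ y‖ = 1 := by
  obtain ⟨n, hn⟩ := pow_unbounded_of_one_lt ‖y‖
    (by exact_mod_cast (Fact.out : p.Prime).one_lt : (1 : ℝ) < p)
  have h : χ y ^ p ^ n = 1 := by
    rw [← AddChar.map_nsmul_eq_pow]
    apply hχ
    rw [nsmul_eq_mul, Nat.cast_pow, norm_mul, norm_pow, Padic.norm_p, inv_pow]
    exact inv_mul_le_one_of_le₀ hn.le (by positivity)
  exact Complex.norm_eq_one_of_pow_eq_one h (pow_ne_zero _ (Fact.out : p.Prime).ne_zero)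

variable {p} in
/-- A character of `ℚ_[p]` trivial on the unit ball is continuous. -/
lemma continuous_addChar {χ : AddChar ℚ_[p] ℂ} (hχ : ∀ y : ℚ_[p], ‖y‖ ≤ 1 → χ y = 1) :
    Continuous χ := by
  refine IsLocallyConstant.continuous ((IsLocallyConstant.iff_eventually_eq _).2 fun y => ?_)
  filter_upwards [Metric.closedBall_mem_nhds y one_pos] with z hz
  rw [← sub_add_cancel z y, AddChar.map_add_eq_mul, hχ _ (by simpa [dist_eq_norm] using hz),
    one_mul]

theorem stmt5 (χ : AddChar ℚ_[p] ℂ) (hχ : ∀ y : ℚ_[p], χ y = 1 ↔ ‖y‖ ≤ 1) (r : ℤ) (α t : ℝ) (hα : 0 < α) (ht : 0 < t) (x : ℚ_[p]) :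
    0 ≤ (heatKernel p χ r α t x).re ∧ (heatKernel p χ r α t x).im = 0 := by
  have h1 : ∀ y : ℚ_[p], ‖y‖ ≤ 1 → χ y = 1 := fun y => (hχ y).2
  have hp : (0 : ℝ) < p := by exact_mod_cast (Fact.out : p.Prime).pos
  let w : ℝ → ℝ := fun a => Real.exp (-(t * ((max a ((p:ℝ)^r)) ^ α - (p:ℝ) ^ ((r:ℝ)*α))))
  have hw : Antitone w := fun a b hab => by
    have : (0 : ℝ) ≤ max a ((p:ℝ)^r) := le_max_of_le_right (zpow_pos hp r).le
    simp only [w]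
    gcongr
  let c : AddChar ℚ_[p] ℂ := χ.compAddMonoidHom (AddMonoidHom.mulLeft (-x))
  have hc (ξ : ℚ_[p]) : c ξ = χ (-(x * ξ)) := by simp [c]
  have : (μp p).IsAddHaarMeasure := by unfold μp; infer_instance
  obtain ⟨v, hv, h⟩ := exists_nonneg_integral_addChar_mul (μp p) c
    (((continuous_addChar h1).comp (continuous_const.mul continuous_id)).measurable)
    (fun g => norm_addChar_eq_one h1 _) (fun ξ => w ‖ξ‖) (hw.measurable.comp measurable_norm)
    (fun _ => (Real.exp_pos _).le) (fun g => by simp only [norm_neg])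
    (fun g => hw (by simp))
    (fun g k => by
      rw [← hw.map_max]
      exact hw (Padic.nonarchimedean g k))
  have hk : heatKernel p χ r α t x = v := by
    rw [← h, heatKernel]
    congr 1 with ξ
    rw [hc, Complex.ofReal_exp, Complex.ofReal_neg]
  simp [hk, hv]

end
end

section
/- For a prime p, α > 0, integer r, and a Bruhat–Schwartz function φ on ℚ_p, the operator H^α φ := 𝓕^{-1}[(max(|ξ|_p,p^r)^α - p^{rα})·𝓕φ] admits the integral representation (H^α φ)(x) = (1-p^α)/(1-p^{α+1})·[ p^{r(α+1)} ∫_{|y|_p ≤ p^{-r}} (φ(x-y) - φ(x)) dy - p^{α+1} ∫_{|y|_p ≤ p^{-r}} (φ(x-y) - φ(x))/|y|_p^{α+1} dy ]. -/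
open MeasureTheory Filter Topology

noncomputable section

variable (p : ℕ) [Fact p.Prime]

section Balls

instance : (μp p).IsAddHaarMeasure := by
  unfold μp; infer_instance

lemma cast_prime_pos : (0 : ℝ) < p := by
  exact_mod_cast (Fact.out : p.Prime).pos

lemma one_lt_cast_prime : (1 : ℝ) < p := by
  exact_mod_cast (Fact.out : p.Prime).one_lt

/-- The closed ball of radius `p ^ k` around `0`. -/
def zpowBall (k : ℤ) : Set ℚ_[p] := {y | ‖y‖ ≤ (p : ℝ) ^ k}

lemma zpowBall_eq_closedBall (k : ℤ) : zpowBall p k = Metric.closedBall 0 ((p : ℝ) ^ k) := by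
  ext y; simp [zpowBall]

lemma isCompact_zpowBall (k : ℤ) : IsCompact (zpowBall p k) := by
  rw [zpowBall_eq_closedBall]; exact isCompact_closedBall 0 _

lemma isOpen_zpowBall (k : ℤ) : IsOpen (zpowBall p k) := by
  rw [zpowBall_eq_closedBall]
  exact IsUltrametricDist.isOpen_closedBall _ (zpow_pos (cast_prime_pos p) k).ne'

lemma measurableSet_zpowBall (k : ℤ) : MeasurableSet (zpowBall p k) :=
  (isOpen_zpowBall p k).measurableSet

lemma zpowBall_mono {j k : ℤ} (h : j ≤ k) : zpowBall p j ⊆ zpowBall p k := fun _ hy ↦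
  le_trans (show ‖_‖ ≤ _ from hy) (zpow_le_zpow_right₀ (one_lt_cast_prime p).le h)

lemma isCompact_zpowBall_diff (j k : ℤ) : IsCompact (zpowBall p j \ zpowBall p k) :=
  (isCompact_zpowBall p j).diff (isOpen_zpowBall p k)

variable {p} in
lemma add_mem_zpowBall_iff {k : ℤ} {y z : ℚ_[p]} (hz : z ∈ zpowBall p k) :
    y + z ∈ zpowBall p k ↔ y ∈ zpowBall p k := by
  refine ⟨fun h ↦ ?_, fun h ↦ (Padic.nonarchimedean y z).trans (max_le h hz)⟩
  have := (Padic.nonarchimedean (y + z) (-z)).trans (max_le h (by rw [norm_neg]; exact hz))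
  rwa [add_neg_cancel_right] at this

lemma zpowBall_succ_eq_iUnion (k : ℤ) :
    zpowBall p (k + 1) =
      ⋃ i : Fin p, (fun y ↦ (-((i : ℕ) * (p : ℚ_[p]) ^ (-(k + 1)))) + y) ⁻¹' zpowBall p k := by
  have hp := cast_prime_pos p
  have hp0 : (p : ℚ_[p]) ≠ 0 := by exact_mod_cast (Fact.out : p.Prime).ne_zero
  ext y
  simp only [Set.mem_iUnion, Set.mem_preimage]
  constructor
  · intro hy
    have hz : ‖y * (p : ℚ_[p]) ^ (k + 1)‖ ≤ 1 := by
      rw [norm_mul, Padic.norm_p_zpow, zpow_neg]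
      exact mul_inv_le_one_of_le₀ hy (zpow_pos hp _).le
    obtain ⟨i, hip, hi⟩ := PadicInt.exists_mem_range (⟨_, hz⟩ : ℤ_[p])
    refine ⟨⟨i, hip⟩, ?_⟩
    have h1 : ‖y * (p : ℚ_[p]) ^ (k + 1) - i‖ < (p : ℝ) ^ (0 : ℤ) := by
      rw [zpow_zero]
      exact PadicInt.mem_nonunits.1 ((IsLocalRing.mem_maximalIdeal _).1 hi)
    rw [Padic.norm_lt_pow_iff_norm_le_pow_sub_one] at h1
    have h2 : -((i : ℚ_[p]) * (p : ℚ_[p]) ^ (-(k + 1))) + y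
        = (y * (p : ℚ_[p]) ^ (k + 1) - i) * (p : ℚ_[p]) ^ (-(k + 1)) := by
      rw [sub_mul, mul_assoc, ← zpow_add₀ hp0]; simp; ring
    change ‖_‖ ≤ _
    rw [h2, norm_mul, Padic.norm_p_zpow, neg_neg]
    calc _ ≤ (p : ℝ) ^ (0 - 1 : ℤ) * (p : ℝ) ^ (k + 1) := by gcongr
      _ = (p : ℝ) ^ k := by rw [← zpow_add₀ hp.ne']; congr 1; ring
  · rintro ⟨i, hi⟩
    have h3 : (i : ℕ) * (p : ℚ_[p]) ^ (-(k + 1)) ∈ zpowBall p (k + 1) := by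
      change ‖_‖ ≤ _
      rw [norm_mul, Padic.norm_p_zpow, neg_neg]
      have := Padic.norm_int_le_one (p := p) (i : ℕ)
      exact mul_le_of_le_one_left (zpow_pos hp _).le (by exact_mod_cast this)
    have := (add_mem_zpowBall_iff h3).2 (zpowBall_mono p (by lia : k ≤ k + 1) hi)
    simpa using this

lemma measure_zpowBall_succ (k : ℤ) :
    (μp p) (zpowBall p (k + 1)) = p * (μp p) (zpowBall p k) := by
  have hp := cast_prime_pos p
  rw [zpowBall_succ_eq_iUnion, measure_iUnion]
  · simp [measure_preimage_add]
  · intro i j hij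
    refine Set.disjoint_left.2 fun y hi hj ↦ hij ?_
    simp only [Set.mem_preimage] at hi hj
    have hd : ((i : ℤ) - (j : ℤ) : ℚ_[p]) * (p : ℚ_[p]) ^ (-(k + 1)) ∈ zpowBall p k := by
      have := (Padic.nonarchimedean _ _).trans
        (max_le hj ((norm_neg _).trans_le hi) : max _ _ ≤ (p : ℝ) ^ k)
      change ‖_‖ ≤ _
      rwa [show ((i : ℤ) - (j : ℤ) : ℚ_[p]) * (p : ℚ_[p]) ^ (-(k + 1))
        = -((j : ℕ) * (p : ℚ_[p]) ^ (-(k + 1))) + y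
          + -(-((i : ℕ) * (p : ℚ_[p]) ^ (-(k + 1))) + y) by push_cast; ring]
    have hlt : ‖(((i : ℤ) - (j : ℤ) : ℤ) : ℚ_[p])‖ < 1 := by
      change ‖_‖ ≤ _ at hd
      rw [norm_mul, Padic.norm_p_zpow, neg_neg, zpow_add_one₀ hp.ne', mul_left_comm] at hd
      have h1 := le_of_mul_le_mul_left (hd.trans_eq (mul_one _).symm) (zpow_pos hp k)
      push_cast
      by_contra! hc
      have := one_lt_cast_prime p
      push_cast at h1
      nlinarith
    rw [Padic.norm_intCast_lt_one_iff] at hlt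
    have h0 := Int.eq_zero_of_abs_lt_dvd hlt (by rw [abs_lt]; constructor <;> omega)
    exact Fin.ext (by lia)
  · exact fun i ↦ (measurableSet_zpowBall p k).preimage (measurable_const_add _)

lemma measure_zpowBall (k : ℤ) : (μp p).real (zpowBall p k) = (p : ℝ) ^ k := by
  have hp := cast_prime_pos p
  have hs : ∀ k, (μp p).real (zpowBall p (k + 1)) = p * (μp p).real (zpowBall p k) := fun k ↦ by
    simp [Measure.real, measure_zpowBall_succ]
  induction k using Int.induction_on with
  | zero =>
    have : zpowBall p 0 = (padicUnitBall p : Set ℚ_[p]) := by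
      change _ = Metric.closedBall 0 1
      rw [zpowBall_eq_closedBall, zpow_zero]
    rw [this, Measure.real, μp, Measure.addHaarMeasure_self]; simp
  | succ n ih => rw [hs, ih, zpow_add_one₀ hp.ne', mul_comm]
  | pred n ih =>
    have h := hs (-n - 1)
    rw [sub_add_cancel, ih] at h
    rw [zpow_sub_one₀ hp.ne', h]; field_simp

end Balls

section Fourier

variable {p}

lemma continuous_of_forall_norm_sub_le {f : ℚ_[p] → ℂ} {ε : ℝ} (hε : 0 < ε)
    (hf : ∀ x y : ℚ_[p], ‖x - y‖ ≤ ε → f x = f y) : Continuous f := by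
  refine IsLocallyConstant.continuous ((IsLocallyConstant.iff_eventually_eq f).2 fun x ↦ ?_)
  filter_upwards [Metric.closedBall_mem_nhds x hε] with y hy
  exact hf y x (by rwa [← dist_eq_norm])

lemma continuous_of_trivial_on_unitBall {χ : AddChar ℚ_[p] ℂ}
    (hχ : ∀ y : ℚ_[p], χ y = 1 ↔ ‖y‖ ≤ 1) : Continuous χ :=
  continuous_of_forall_norm_sub_le one_pos fun x y h ↦ by
    rw [← sub_add_cancel x y, AddChar.map_add_eq_mul, (hχ _).2 h, one_mul]

lemma setIntegral_zpowBall_comp_add_right (f : ℚ_[p] → ℂ) {k : ℤ} {z : ℚ_[p]}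
    (hz : z ∈ zpowBall p k) :
    ∫ y in zpowBall p k, f (y + z) ∂(μp p) = ∫ y in zpowBall p k, f y ∂(μp p) := by
  rw [← integral_indicator (measurableSet_zpowBall p k),
    ← integral_indicator (measurableSet_zpowBall p k),
    ← integral_add_right_eq_self ((zpowBall p k).indicator f) z]
  congr 1 with y
  classical
  rw [Set.indicator_apply, Set.indicator_apply, if_congr (add_mem_zpowBall_iff hz) rfl rfl]

lemma norm_ge_of_zpow_lt {ξ : ℚ_[p]} {k : ℤ} (h : (p : ℝ) ^ k < ‖ξ‖) :
    (p : ℝ) ^ (k + 1) ≤ ‖ξ‖ := by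
  by_contra! hc
  exact h.not_ge ((Padic.norm_le_pow_iff_norm_lt_pow_add_one ξ k).2 hc)

lemma exists_mem_zpowBall_one_lt_norm_mul {ξ : ℚ_[p]} {k : ℤ} (h : (p : ℝ) ^ (-k) < ‖ξ‖) :
    ∃ z ∈ zpowBall p k, 1 < ‖ξ * z‖ := by
  have hp := cast_prime_pos p
  have hk := zpow_pos hp k
  refine ⟨(p : ℚ_[p]) ^ (-k), by simp [zpowBall], ?_⟩
  rw [norm_mul, Padic.norm_p_zpow, neg_neg]
  rwa [zpow_neg, inv_lt_iff_one_lt_mul₀ hk] at h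

lemma setIntegral_zpowBall_addChar {χ : AddChar ℚ_[p] ℂ} (hχ : ∀ y : ℚ_[p], χ y = 1 ↔ ‖y‖ ≤ 1)
    (ξ : ℚ_[p]) (k : ℤ) :
    ∫ y in zpowBall p k, χ (y * ξ) ∂(μp p) =
      if ‖ξ‖ ≤ (p : ℝ) ^ (-k) then (p : ℂ) ^ k else 0 := by
  have hp := cast_prime_pos p
  split_ifs with h
  · have h1 : ∀ y ∈ zpowBall p k, χ (y * ξ) = 1 := fun y hy ↦ by
      rw [hχ, norm_mul]
      calc _ ≤ (p : ℝ) ^ k * (p : ℝ) ^ (-k) := by gcongr; exact hy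
        _ = 1 := by rw [← zpow_add₀ hp.ne']; simp
    rw [setIntegral_congr_fun (measurableSet_zpowBall p k) h1]
    simp [measure_zpowBall]
  · obtain ⟨z, hz, hz1⟩ := exists_mem_zpowBall_one_lt_norm_mul (not_le.1 h)
    have h1 := setIntegral_zpowBall_comp_add_right (fun y ↦ χ (y * ξ)) hz
    simp only [add_mul, AddChar.map_add_eq_mul] at h1
    rw [integral_mul_const] at h1
    have h2 : χ (z * ξ) ≠ 1 := fun hc ↦ by
      rw [hχ, mul_comm] at hc; exact hc.not_gt hz1
    exact (mul_right_eq_self₀.1 h1).resolve_left h2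

lemma setIntegral_swap_of_isCompact {D K : Set ℚ_[p]} (hD : IsCompact D) (hK : IsCompact K)
    {f : ℚ_[p] → ℚ_[p] → ℂ} (hf : ContinuousOn (Function.uncurry f) (D ×ˢ K)) :
    ∫ x in D, ∫ y in K, f x y ∂(μp p) ∂(μp p) = ∫ y in K, ∫ x in D, f x y ∂(μp p) ∂(μp p) := by
  refine integral_integral_swap ?_
  rw [Measure.prod_restrict]
  exact hf.integrableOn_compact (hD.prod hK)

section SchwartzBruhat

variable {φ : ℚ_[p] → ℂ} {m : ℤ} {N : ℤ}

lemma integral_mul_eq_setIntegral_zpowBall (hm : ∀ x : ℚ_[p], (p : ℝ) ^ m < ‖x‖ → φ x = 0)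
    (g : ℚ_[p] → ℂ) :
    ∫ y, g y * φ y ∂(μp p) = ∫ y in zpowBall p m, g y * φ y ∂(μp p) := by
  refine (setIntegral_eq_integral_of_forall_compl_eq_zero fun y hy ↦ ?_).symm
  rw [hm y (not_le.1 hy), mul_zero]

lemma continuous_fourier {χ : AddChar ℚ_[p] ℂ} (hχ : ∀ y : ℚ_[p], χ y = 1 ↔ ‖y‖ ≤ 1)
    (hm : ∀ x : ℚ_[p], (p : ℝ) ^ m < ‖x‖ → φ x = 0) :
    Continuous fun ξ ↦ ∫ y, χ (ξ * y) * φ y ∂(μp p) := by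
  have hp := cast_prime_pos p
  refine continuous_of_forall_norm_sub_le (zpow_pos hp (-m)) fun ξ ξ' h ↦ ?_
  congr 1 with y
  by_cases hy : (p : ℝ) ^ m < ‖y‖
  · simp [hm y hy]
  · congr 1
    rw [← sub_add_cancel (ξ * y) (ξ' * y), AddChar.map_add_eq_mul, (hχ _).2, one_mul]
    rw [← sub_mul, norm_mul]
    calc _ ≤ (p : ℝ) ^ (-m) * (p : ℝ) ^ m := by gcongr; exact not_lt.1 hy
      _ = 1 := by rw [← zpow_add₀ hp.ne']; simp

lemma fourier_eq_zero {χ : AddChar ℚ_[p] ℂ} (hχ : ∀ y : ℚ_[p], χ y = 1 ↔ ‖y‖ ≤ 1)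
    (hN : ∀ x y : ℚ_[p], ‖x - y‖ ≤ (p : ℝ) ^ (-N) → φ x = φ y) {ξ : ℚ_[p]}
    (hξ : (p : ℝ) ^ N < ‖ξ‖) : ∫ y, χ (ξ * y) * φ y ∂(μp p) = 0 := by
  obtain ⟨z, hz, hz1⟩ := exists_mem_zpowBall_one_lt_norm_mul (k := -N) (by rwa [neg_neg])
  have h1 := integral_add_right_eq_self (μ := μp p) (fun y ↦ χ (ξ * y) * φ y) z
  have h2 : ∀ y, φ (y + z) = φ y := fun y ↦ hN _ _ (by rwa [add_sub_cancel_left])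
  simp only [mul_add, AddChar.map_add_eq_mul, h2, mul_right_comm _ (χ (ξ * z))] at h1
  rw [integral_mul_const] at h1
  exact (mul_right_eq_self₀.1 h1).resolve_left fun hc ↦ ((hχ _).1 hc).not_gt hz1

lemma fourier_inversion {χ : AddChar ℚ_[p] ℂ} (hχ : ∀ y : ℚ_[p], χ y = 1 ↔ ‖y‖ ≤ 1)
    (hm : ∀ x : ℚ_[p], (p : ℝ) ^ m < ‖x‖ → φ x = 0)
    (hN : ∀ x y : ℚ_[p], ‖x - y‖ ≤ (p : ℝ) ^ (-N) → φ x = φ y) (x : ℚ_[p]) :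
    ∫ ξ in zpowBall p N, χ (-(x * ξ)) * ∫ y, χ (ξ * y) * φ y ∂(μp p) ∂(μp p) = φ x := by
  have hp := cast_prime_pos p
  have hχc := continuous_of_trivial_on_unitBall hχ
  have hφc := continuous_of_forall_norm_sub_le (zpow_pos hp (-N)) hN
  simp_rw [integral_mul_eq_setIntegral_zpowBall hm, ← integral_const_mul]
  rw [setIntegral_swap_of_isCompact (isCompact_zpowBall p N) (isCompact_zpowBall p m)
    (by fun_prop)]
  have h1 : ∀ ξ y, χ (-(x * ξ)) * (χ (ξ * y) * φ y) = χ (ξ * (y - x)) * φ y := fun ξ y ↦ by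
    rw [← mul_assoc, ← AddChar.map_add_eq_mul]; congr 2; ring
  simp_rw [h1, integral_mul_const, setIntegral_zpowBall_addChar hχ]
  rw [← integral_mul_eq_setIntegral_zpowBall hm, ← integral_add_right_eq_self _ x]
  have h2 : ∀ y, (if ‖y + x - x‖ ≤ (p : ℝ) ^ (-N) then (p : ℂ) ^ N else 0) * φ (y + x) =
      (zpowBall p (-N)).indicator (fun _ ↦ (p : ℂ) ^ N * φ x) y := fun y ↦ by
    classical
    rw [Set.indicator_apply, add_sub_cancel_right]
    by_cases hy : ‖y‖ ≤ (p : ℝ) ^ (-N)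
    · rw [if_pos hy, if_pos (c := y ∈ zpowBall p (-N)) hy,
        hN (y + x) x (by rwa [add_sub_cancel_right])]
    · rw [if_neg hy, if_neg (c := y ∈ zpowBall p (-N)) hy, zero_mul]
  simp_rw [h2]
  rw [integral_indicator (measurableSet_zpowBall p _), setIntegral_const, measure_zpowBall]
  have hp' : (p : ℂ) ≠ 0 := by exact_mod_cast hp.ne'
  rw [Complex.real_smul, ← mul_assoc]
  push_cast
  rw [← zpow_add₀ hp']
  simp

lemma setIntegral_kernel_symbol_mul_fourier {χ : AddChar ℚ_[p] ℂ}
    (hχ : ∀ y : ℚ_[p], χ y = 1 ↔ ‖y‖ ≤ 1)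
    (hm : ∀ x : ℚ_[p], (p : ℝ) ^ m < ‖x‖ → φ x = 0)
    (hN : ∀ x y : ℚ_[p], ‖x - y‖ ≤ (p : ℝ) ^ (-N) → φ x = φ y)
    {D : Set ℚ_[p]} (hD : IsCompact D) {κ : ℚ_[p] → ℂ} (hκ : ContinuousOn κ D) (x : ℚ_[p]) :
    ∫ ξ in zpowBall p N, χ (-(x * ξ)) * (∫ w in D, κ w * (χ (w * ξ) - 1) ∂(μp p)) *
        (∫ y, χ (ξ * y) * φ y ∂(μp p)) ∂(μp p) =
      ∫ w in D, κ w * (φ (x - w) - φ x) ∂(μp p) := by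
  have hχc := continuous_of_trivial_on_unitBall hχ
  have hFc := continuous_fourier hχ hm
  have hinv := fourier_inversion hχ hm hN
  set F : ℚ_[p] → ℂ := fun ξ ↦ ∫ y, χ (ξ * y) * φ y ∂(μp p)
  have h1 : ∀ ξ, χ (-(x * ξ)) * (∫ w in D, κ w * (χ (w * ξ) - 1) ∂(μp p)) * F ξ =
      ∫ w in D, κ w * (χ (-((x - w) * ξ)) * F ξ - χ (-(x * ξ)) * F ξ) ∂(μp p) := fun ξ ↦ by
    rw [mul_right_comm, ← integral_const_mul]
    congr 1 with w
    rw [show -((x - w) * ξ) = -(x * ξ) + w * ξ by ring, AddChar.map_add_eq_mul]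
    ring
  have hint : ∀ z, IntegrableOn (fun ξ ↦ χ (-(z * ξ)) * F ξ) (zpowBall p N) (μp p) := fun z ↦
    ContinuousOn.integrableOn_compact (isCompact_zpowBall p N) (by fun_prop)
  calc _ = ∫ ξ in zpowBall p N,
        ∫ w in D, κ w * (χ (-((x - w) * ξ)) * F ξ - χ (-(x * ξ)) * F ξ) ∂(μp p) ∂(μp p) := by
        simp_rw [← h1]; rfl
    _ = ∫ w in D, ∫ ξ in zpowBall p N,
          κ w * (χ (-((x - w) * ξ)) * F ξ - χ (-(x * ξ)) * F ξ) ∂(μp p) ∂(μp p) := by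
        refine setIntegral_swap_of_isCompact (isCompact_zpowBall p N) hD ?_
        refine ContinuousOn.mul (hκ.comp continuousOn_snd fun z hz ↦ hz.2) ?_
        fun_prop
    _ = _ := by
        congr 1 with w
        rw [integral_const_mul, integral_sub (hint _) (hint _), hinv, hinv]

end SchwartzBruhat

end Fourier

section Symbol

variable {p}

lemma norm_eq_of_mem_zpowBall_diff {j : ℤ} {w : ℚ_[p]}
    (hw : w ∈ zpowBall p (-j) \ zpowBall p (-(j + 1))) : ‖w‖ = (p : ℝ) ^ (-j) := by
  refine le_antisymm hw.1 ?_
  have := norm_ge_of_zpow_lt (not_le.1 hw.2)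
  rwa [show -(j + 1) + 1 = -j by ring] at this

lemma cast_prime_zpow_rpow (j : ℤ) (α : ℝ) : ((p : ℝ) ^ j) ^ α = ((p : ℝ) ^ α) ^ j := by
  have hp := (cast_prime_pos p).le
  rw [← Real.rpow_intCast, ← Real.rpow_intCast, ← Real.rpow_mul hp, ← Real.rpow_mul hp, mul_comm]

lemma ne_zero_of_mem_zpowBall_diff {j k : ℤ} {w : ℚ_[p]} (hw : w ∈ zpowBall p j \ zpowBall p k) :
    ‖w‖ ≠ 0 := fun h ↦ hw.2 (h.trans_le (zpow_pos (cast_prime_pos p) k).le)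

lemma integrableOn_addChar_sub_one {χ : AddChar ℚ_[p] ℂ}
    (hχ : ∀ y : ℚ_[p], χ y = 1 ↔ ‖y‖ ≤ 1) (ξ : ℚ_[p]) (k : ℤ) :
    IntegrableOn (fun w ↦ χ (w * ξ) - 1) (zpowBall p k) (μp p) := by
  have := continuous_of_trivial_on_unitBall hχ
  exact ContinuousOn.integrableOn_compact (isCompact_zpowBall p k) (by fun_prop)

lemma continuousOn_addChar_sub_one_div {χ : AddChar ℚ_[p] ℂ}
    (hχ : ∀ y : ℚ_[p], χ y = 1 ↔ ‖y‖ ≤ 1) (ξ : ℚ_[p]) (α : ℝ) (j k : ℤ) :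
    ContinuousOn (fun w ↦ (χ (w * ξ) - 1) / ((‖w‖ ^ α : ℝ) : ℂ))
      (zpowBall p j \ zpowBall p k) := by
  have hχc := continuous_of_trivial_on_unitBall hχ
  refine ContinuousOn.div (by fun_prop) (Complex.continuous_ofReal.comp_continuousOn
    (continuous_norm.continuousOn.rpow_const fun w hw ↦
      .inl (ne_zero_of_mem_zpowBall_diff hw))) fun w hw ↦ ?_
  exact_mod_cast (Real.rpow_pos_of_pos
    (lt_of_le_of_ne (norm_nonneg w) (ne_zero_of_mem_zpowBall_diff hw).symm) _).ne'

lemma setIntegral_zpowBall_addChar_sub_one {χ : AddChar ℚ_[p] ℂ}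
    (hχ : ∀ y : ℚ_[p], χ y = 1 ↔ ‖y‖ ≤ 1) (ξ : ℚ_[p]) (j : ℤ) :
    ∫ w in zpowBall p (-j), (χ (w * ξ) - 1) ∂(μp p) =
      if ‖ξ‖ ≤ (p : ℝ) ^ j then 0 else -(p : ℂ) ^ (-j) := by
  have hχc := continuous_of_trivial_on_unitBall hχ
  rw [integral_sub (ContinuousOn.integrableOn_compact (isCompact_zpowBall p _) (by fun_prop))
    (ContinuousOn.integrableOn_compact (isCompact_zpowBall p _) (by fun_prop)),
    setIntegral_zpowBall_addChar hχ, setIntegral_const, measure_zpowBall, neg_neg]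
  split_ifs <;> simp

lemma setIntegral_zpowBall_diff_addChar_sub_one {χ : AddChar ℚ_[p] ℂ}
    (hχ : ∀ y : ℚ_[p], χ y = 1 ↔ ‖y‖ ≤ 1) (ξ : ℚ_[p]) {j k : ℤ} (h : j ≤ k) :
    ∫ w in zpowBall p (-j) \ zpowBall p (-k), (χ (w * ξ) - 1) ∂(μp p) =
      (if ‖ξ‖ ≤ (p : ℝ) ^ j then 0 else -(p : ℂ) ^ (-j)) -
        if ‖ξ‖ ≤ (p : ℝ) ^ k then 0 else -(p : ℂ) ^ (-k) := by
  rw [setIntegral_sdiff (measurableSet_zpowBall p _) (integrableOn_addChar_sub_one hχ ξ _)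
    (zpowBall_mono p (neg_le_neg h)), setIntegral_zpowBall_addChar_sub_one hχ,
    setIntegral_zpowBall_addChar_sub_one hχ]

lemma setIntegral_shell_addChar_sub_one_div {χ : AddChar ℚ_[p] ℂ}
    (hχ : ∀ y : ℚ_[p], χ y = 1 ↔ ‖y‖ ≤ 1) (ξ : ℚ_[p]) (α : ℝ) (j : ℤ) :
    ∫ w in zpowBall p (-j) \ zpowBall p (-(j + 1)),
        (χ (w * ξ) - 1) / ((‖w‖ ^ α : ℝ) : ℂ) ∂(μp p) =
      ((((p : ℝ) ^ α) ^ j : ℝ) : ℂ) * ((if ‖ξ‖ ≤ (p : ℝ) ^ j then 0 else -(p : ℂ) ^ (-j)) -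
        if ‖ξ‖ ≤ (p : ℝ) ^ (j + 1) then 0 else -(p : ℂ) ^ (-(j + 1))) := by
  rw [← setIntegral_zpowBall_diff_addChar_sub_one hχ ξ (by lia : j ≤ j + 1), ← integral_const_mul]
  refine setIntegral_congr_fun ((measurableSet_zpowBall p _).diff (measurableSet_zpowBall p _))
    fun w hw ↦ ?_
  simp only [norm_eq_of_mem_zpowBall_diff hw, cast_prime_zpow_rpow]
  rw [zpow_neg, Complex.ofReal_inv, div_inv_eq_mul, mul_comm]

lemma setIntegral_addChar_sub_one_div_succ {χ : AddChar ℚ_[p] ℂ}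
    (hχ : ∀ y : ℚ_[p], χ y = 1 ↔ ‖y‖ ≤ 1) (ξ : ℚ_[p]) (α : ℝ) (r : ℤ) (n : ℕ) :
    ∫ w in zpowBall p (-r) \ zpowBall p (-(r + n + 1)),
        (χ (w * ξ) - 1) / ((‖w‖ ^ α : ℝ) : ℂ) ∂(μp p) =
      (∫ w in zpowBall p (-r) \ zpowBall p (-(r + n)),
        (χ (w * ξ) - 1) / ((‖w‖ ^ α : ℝ) : ℂ) ∂(μp p)) +
      ∫ w in zpowBall p (-(r + n)) \ zpowBall p (-(r + n + 1)),
        (χ (w * ξ) - 1) / ((‖w‖ ^ α : ℝ) : ℂ) ∂(μp p) := by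
  rw [← setIntegral_union]
  · congr 2
    exact (Set.sdiff_union_sdiff_cancel (zpowBall_mono p (by lia)) (zpowBall_mono p (by lia))).symm
  · exact Set.disjoint_left.2 fun w h1 h2 ↦ h1.2 h2.1
  · exact (measurableSet_zpowBall p _).diff (measurableSet_zpowBall p _)
  · exact (continuousOn_addChar_sub_one_div hχ ξ α _ _).integrableOn_compact
      (isCompact_zpowBall_diff p _ _)
  · exact (continuousOn_addChar_sub_one_div hχ ξ α _ _).integrableOn_compact
      (isCompact_zpowBall_diff p _ _)

lemma setIntegral_addChar_sub_one_div_of_lt {χ : AddChar ℚ_[p] ℂ}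
    (hχ : ∀ y : ℚ_[p], χ y = 1 ↔ ‖y‖ ≤ 1) (ξ : ℚ_[p]) (α : ℝ) (r : ℤ) (n : ℕ)
    (h : (p : ℝ) ^ (r + n) < ‖ξ‖) :
    (((p : ℝ) ^ α : ℝ) - 1 : ℂ) * ∫ w in zpowBall p (-r) \ zpowBall p (-(r + n)),
        (χ (w * ξ) - 1) / ((‖w‖ ^ (α + 1) : ℝ) : ℂ) ∂(μp p) =
      -(1 - 1 / p) * ((((p : ℝ) ^ α : ℝ) : ℂ) ^ (r + n) - (((p : ℝ) ^ α : ℝ) : ℂ) ^ r) := by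
  have hp := cast_prime_pos p
  have hpc : (p : ℂ) ≠ 0 := by exact_mod_cast hp.ne'
  have hac : (((p : ℝ) ^ α : ℝ) : ℂ) ≠ 0 := by exact_mod_cast (Real.rpow_pos_of_pos hp α).ne'
  induction n with
  | zero => simp
  | succ n ih =>
    push_cast at h
    rw [← add_assoc] at h
    have h' : (p : ℝ) ^ (r + n) < ‖ξ‖ :=
      (zpow_lt_zpow_right₀ (one_lt_cast_prime p) (by lia)).trans h
    push_cast
    rw [← add_assoc, setIntegral_addChar_sub_one_div_succ hχ, mul_add, ih h',
      setIntegral_shell_addChar_sub_one_div hχ, if_neg h'.not_ge, if_neg h.not_ge,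
      Real.rpow_add_one hp.ne']
    push_cast
    generalize (((p : ℝ) ^ α : ℝ) : ℂ) = a at *
    rw [mul_zpow, neg_add (r + (n : ℤ)) 1, zpow_add₀ hpc (-(r + n)), zpow_neg, zpow_add_one₀ hac]
    have := zpow_ne_zero (r + n) hpc
    field_simp
    ring

lemma setIntegral_kernel_eq_symbol {χ : AddChar ℚ_[p] ℂ}
    (hχ : ∀ y : ℚ_[p], χ y = 1 ↔ ‖y‖ ≤ 1) (ξ : ℚ_[p]) {α : ℝ} (hα : 0 < α) {r N : ℤ}
    (hξ : ξ ∈ zpowBall p N) :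
    ∫ w in zpowBall p (-r) \ zpowBall p (-N),
        ((((1 - (p : ℝ) ^ α) / (1 - (p : ℝ) ^ (α + 1)) : ℝ) : ℂ) *
          ((((p : ℝ) ^ ((r : ℝ) * (α + 1)) : ℝ) : ℂ) -
            (((p : ℝ) ^ (α + 1) : ℝ) : ℂ) / ((‖w‖ ^ (α + 1) : ℝ) : ℂ))) *
          (χ (w * ξ) - 1) ∂(μp p) =
      (((max ‖ξ‖ ((p : ℝ) ^ r)) ^ α - (p : ℝ) ^ ((r : ℝ) * α) : ℝ) : ℂ) := by
  have hp := cast_prime_pos p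
  have hrpow : ∀ β : ℝ, (p : ℝ) ^ ((r : ℝ) * β) = ((p : ℝ) ^ β) ^ r := fun β ↦ by
    rw [← cast_prime_zpow_rpow, Real.rpow_mul hp.le, Real.rpow_intCast]
  have hzero : ∀ k : ℤ, ‖ξ‖ ≤ (p : ℝ) ^ k → ∀ w ∈ zpowBall p (-k), χ (w * ξ) = 1 :=
    fun k hk w hw ↦ by
      rw [hχ, norm_mul]
      calc _ ≤ (p : ℝ) ^ (-k) * (p : ℝ) ^ k := by gcongr; exact hw
        _ = 1 := by rw [← zpow_add₀ hp.ne']; simp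
  have hmeas : ∀ k, MeasurableSet (zpowBall p (-r) \ zpowBall p (-k)) := fun k ↦
    (measurableSet_zpowBall p _).diff (measurableSet_zpowBall p _)
  rcases le_or_gt ‖ξ‖ ((p : ℝ) ^ r) with h | h
  · rw [max_eq_right h, hrpow α, cast_prime_zpow_rpow, sub_self, Complex.ofReal_zero]
    refine setIntegral_eq_zero_of_forall_eq_zero fun w hw ↦ ?_
    rw [hzero r h w hw.1]; simp
  have hξ0 : ξ ≠ 0 := norm_pos_iff.1 ((zpow_pos hp r).trans h)
  obtain ⟨n, hn⟩ : ∃ n : ℕ, ‖ξ‖ = (p : ℝ) ^ (r + n + 1) := by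
    have hv := Padic.norm_eq_zpow_neg_valuation hξ0
    rw [hv, zpow_lt_zpow_iff_right₀ (one_lt_cast_prime p)] at h
    exact ⟨(-ξ.valuation - r - 1).toNat, by rw [hv]; congr 1; lia⟩
  have hnN : r + n + 1 ≤ N := by
    change ‖ξ‖ ≤ _ at hξ
    rwa [hn, zpow_le_zpow_iff_right₀ (one_lt_cast_prime p)] at hξ
  rw [setIntegral_eq_of_subset_of_forall_sdiff_eq_zero
    (s := zpowBall p (-r) \ zpowBall p (-(r + n + 1))) (hmeas N)
    (Set.sdiff_subset_sdiff_right (zpowBall_mono p (neg_le_neg hnN))) fun w hw ↦ by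
      have : w ∈ zpowBall p (-(r + n + 1)) := by
        by_contra hc
        exact hw.2 ⟨hw.1.1, hc⟩
      rw [hzero _ hn.le w this]; simp]
  have hlt : (p : ℝ) ^ (r + n) < ‖ξ‖ := by
    rw [hn]; exact zpow_lt_zpow_right₀ (one_lt_cast_prime p) (by lia)
  have h1 := setIntegral_addChar_sub_one_div_of_lt hχ ξ α r n hlt
  have h2 := setIntegral_addChar_sub_one_div_succ hχ ξ (α + 1) r n
  rw [setIntegral_shell_addChar_sub_one_div hχ, if_neg hlt.not_ge, if_pos hn.le] at h2
  have h3 := setIntegral_zpowBall_diff_addChar_sub_one hχ ξ (by lia : r ≤ r + n + 1)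
  rw [if_neg h.not_ge, if_pos hn.le] at h3
  have hint1 : IntegrableOn (fun w ↦ χ (w * ξ) - 1)
      (zpowBall p (-r) \ zpowBall p (-(r + n + 1))) (μp p) :=
    (integrableOn_addChar_sub_one hχ ξ _).mono_set Set.sdiff_subset
  have hint2 := (continuousOn_addChar_sub_one_div hχ ξ (α + 1) (-r)
    (-(r + n + 1))).integrableOn_compact (μ := μp p) (isCompact_zpowBall_diff p _ _)
  simp_rw [mul_assoc, sub_mul, div_mul_eq_mul_div, mul_div_assoc]
  rw [integral_const_mul, integral_sub (hint1.const_mul _) (hint2.const_mul _),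
    integral_const_mul, integral_const_mul, h2, h3, max_eq_left h.le, hn, cast_prime_zpow_rpow,
    hrpow, hrpow, Real.rpow_add_one hp.ne']
  have ha : 1 < (p : ℝ) ^ α := Real.one_lt_rpow (one_lt_cast_prime p) hα
  have hp1 := one_lt_cast_prime p
  have hpc : (p : ℂ) ≠ 0 := by exact_mod_cast hp.ne'
  have hac : (((p : ℝ) ^ α : ℝ) : ℂ) ≠ 0 := by exact_mod_cast (Real.rpow_pos_of_pos hp α).ne'
  have ha1 : (((p : ℝ) ^ α : ℝ) : ℂ) - 1 ≠ 0 := by exact_mod_cast (by linarith)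
  have hap : 1 - (((p : ℝ) ^ α : ℝ) : ℂ) * p ≠ 0 := by exact_mod_cast (by nlinarith)
  rw [mul_comm, ← eq_div_iff ha1] at h1
  rw [h1]
  push_cast
  generalize (((p : ℝ) ^ α : ℝ) : ℂ) = a at *
  rw [mul_zpow, mul_zpow, zpow_neg, zpow_neg, zpow_add_one₀ hac]
  have := zpow_ne_zero (r + n) hpc
  have := zpow_ne_zero r hpc
  field_simp
  ring

end Symbol

theorem stmt11 (χ : AddChar ℚ_[p] ℂ) (hχ : ∀ y : ℚ_[p], χ y = 1 ↔ ‖y‖ ≤ 1) (r : ℤ) (α : ℝ) (hα : 0 < α)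
    (φ : ℚ_[p] → ℂ)
    (hφconst : ∃ n : ℤ, ∀ x y : ℚ_[p], ‖x - y‖ ≤ (p:ℝ)^n → φ x = φ y)
    (hφsupp : ∃ m : ℤ, ∀ x : ℚ_[p], (p:ℝ)^m < ‖x‖ → φ x = 0)
    (x : ℚ_[p]) :
    (∫ ξ, (χ (-(x*ξ)) : ℂ) * (((max ‖ξ‖ ((p:ℝ)^r)) ^ α - (p:ℝ)^((r:ℝ)*α) : ℝ) : ℂ) *
        (∫ y, (χ (ξ*y) : ℂ) * φ y ∂(μp p)) ∂(μp p))
      = (((1 - (p:ℝ)^α)/(1 - (p:ℝ)^(α+1)) : ℝ) : ℂ) *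
        ((((p:ℝ)^((r:ℝ)*(α+1)) : ℝ) : ℂ) *
            (∫ y in {y : ℚ_[p] | ‖y‖ ≤ (p:ℝ)^(-r)}, (φ (x-y) - φ x) ∂(μp p))
          - (((p:ℝ)^(α+1) : ℝ) : ℂ) *
            (∫ y in {y : ℚ_[p] | ‖y‖ ≤ (p:ℝ)^(-r)},
              (φ (x-y) - φ x) / ((‖y‖ ^ (α+1) : ℝ) : ℂ) ∂(μp p))) := by
  obtain ⟨n, hn⟩ := hφconst
  obtain ⟨m, hm⟩ := hφsupp
  have hp := cast_prime_pos p
  obtain ⟨N, hnN⟩ : ∃ N : ℤ, -N ≤ n := ⟨-n, by lia⟩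
  have hN : ∀ x y : ℚ_[p], ‖x - y‖ ≤ (p : ℝ) ^ (-N) → φ x = φ y := fun x y h ↦
    hn x y (zpowBall_mono p hnN h)
  have hφc := continuous_of_forall_norm_sub_le (zpow_pos hp (-N)) hN
  have hdiff : ∀ y ∈ zpowBall p (-N), φ (x - y) - φ x = 0 := fun y hy ↦ by
    rw [hN (x - y) x (by rw [sub_sub_cancel_left, norm_neg]; exact hy), sub_self]
  set D := zpowBall p (-r) \ zpowBall p (-N)
  have hDc : IsCompact D := isCompact_zpowBall_diff p _ _
  have hrpow : ContinuousOn (fun y : ℚ_[p] ↦ ((‖y‖ ^ (α + 1) : ℝ) : ℂ)) D :=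
    Complex.continuous_ofReal.comp_continuousOn
      (continuous_norm.continuousOn.rpow_const fun w hw ↦
        .inl (ne_zero_of_mem_zpowBall_diff hw))
  have hrpow0 : ∀ y ∈ D, ((‖y‖ ^ (α + 1) : ℝ) : ℂ) ≠ 0 := fun y hy ↦ by
    exact_mod_cast (Real.rpow_pos_of_pos
      (lt_of_le_of_ne (norm_nonneg y) (ne_zero_of_mem_zpowBall_diff hy).symm) _).ne'
  have hrestrict : ∀ g : ℚ_[p] → ℂ, (∀ y ∈ zpowBall p (-N), g y = 0) →
      ∫ y in {y : ℚ_[p] | ‖y‖ ≤ (p:ℝ)^(-r)}, g y ∂(μp p) = ∫ y in D, g y ∂(μp p) :=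
    fun g hg ↦ setIntegral_eq_of_subset_of_forall_sdiff_eq_zero (measurableSet_zpowBall p _)
      Set.sdiff_subset fun y hy ↦ hg y (by_contra fun hc ↦ hy.2 ⟨hy.1, hc⟩)
  have hint1 : IntegrableOn (fun y ↦ φ (x - y) - φ x) D (μp p) :=
    ContinuousOn.integrableOn_compact hDc (by fun_prop)
  have hint2 : IntegrableOn (fun y ↦ (φ (x - y) - φ x) / ((‖y‖ ^ (α + 1) : ℝ) : ℂ)) D (μp p) :=
    ContinuousOn.integrableOn_compact hDc (ContinuousOn.div (by fun_prop) hrpow hrpow0)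
  rw [hrestrict _ hdiff, hrestrict _ fun y hy ↦ by rw [hdiff y hy, zero_div],
    ← integral_const_mul, ← integral_const_mul,
    ← integral_sub (hint1.const_mul _) (hint2.const_mul _), ← integral_const_mul,
    ← setIntegral_eq_integral_of_forall_compl_eq_zero (s := zpowBall p N) fun ξ hξ ↦ by
      rw [fourier_eq_zero hχ hN (not_le.1 hξ), mul_zero],
    setIntegral_congr_fun (measurableSet_zpowBall p N) fun ξ hξ ↦ by
      rw [← setIntegral_kernel_eq_symbol hχ ξ hα hξ],
    setIntegral_kernel_symbol_mul_fourier hχ hm hN hDc (κ := fun w ↦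
      (((1 - (p : ℝ) ^ α) / (1 - (p : ℝ) ^ (α + 1)) : ℝ) : ℂ) *
        ((((p : ℝ) ^ ((r : ℝ) * (α + 1)) : ℝ) : ℂ) -
          (((p : ℝ) ^ (α + 1) : ℝ) : ℂ) / ((‖w‖ ^ (α + 1) : ℝ) : ℂ)))
      (continuousOn_const.mul (continuousOn_const.sub (continuousOn_const.div hrpow hrpow0)))]
  congr 1 with y
  ring

end
end
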